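/- arXiv:1512.08278 — 2 statements merged into one kernel-verified Lean document; each statement's English description precedes it below -/
import Mathlib

section
/- Let N ≥ 2, let ρ be a positive semidefinite matrix on ℂ² ⊗ ℂ^N, let k be an integer with 0 ≤ k ≤ N-1, and let α be real with -(2N-k-1)/(3N-2) ≤ α ≤ 1. Then the matrix Λ_k^{2×N}(ρ) := (N-k-1)·ε(ρ) + ∑_{m=0}^{N-1} ε(S_B^m · ρ · (S_B^m)†) + ∑_{m=0}^{k} ε(S_A S_B^m · ρ · (S_A S_B^m)†) + α·ρ is separable. -/
open Matrix Kronecker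
open scoped ComplexOrder

noncomputable section

/-- A Hermitian matrix on ℂ^M ⊗ ℂ^N is separable if it is a finite sum of Kronecker
products of positive semidefinite matrices. -/
def IsSeparableMat {M N : ℕ} (σ : Matrix (Fin M × Fin N) (Fin M × Fin N) ℂ) : Prop :=
  ∃ (k : ℕ) (A : Fin k → Matrix (Fin M) (Fin M) ℂ) (B : Fin k → Matrix (Fin N) (Fin N) ℂ),
    (∀ i, (A i).PosSemidef) ∧ (∀ i, (B i).PosSemidef) ∧ σ = ∑ i, A i ⊗ₖ B i

/-- The pinching onto the diagonal in the standard basis. -/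
def pinch {ι : Type*} [DecidableEq ι] (X : Matrix ι ι ℂ) : Matrix ι ι ℂ :=
  Matrix.diagonal (fun i => X i i)

/-- The cyclic shift unitary on ℂ^d : S|j⟩ = |j+1 mod d⟩. -/
def shift (d : ℕ) : Matrix (Fin d) (Fin d) ℂ :=
  fun i j => if (i : ℕ) = ((j : ℕ) + 1) % d then 1 else 0

end

theorem posSemidef_dotProduct_smul_one_sub_vecMulVec {ι : Type*} [Fintype ι] [DecidableEq ι]
    (w : ι → ℂ) : ((star w ⬝ᵥ w) • (1 : Matrix ι ι ℂ) - vecMulVec w (star w)).PosSemidef := by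
  have hc : 0 ≤ star w ⬝ᵥ w := dotProduct_star_self_nonneg w
  rcases hc.eq_or_lt with h | h
  · simp [dotProduct_star_self_eq_zero.1 h.symm, Matrix.PosSemidef.zero]
  set c := star w ⬝ᵥ w with hcdef
  have hs : star c = c := IsSelfAdjoint.of_nonneg hc
  have hP : vecMulVec w (star w) * vecMulVec w (star w) = c • vecMulVec w (star w) := by
    rw [vecMulVec_mul_vecMulVec, ← hcdef, vecMulVec_smul]
  have key : c • (1 : Matrix ι ι ℂ) - vecMulVec w (star w) = c⁻¹ •
      ((c • (1 : Matrix ι ι ℂ) - vecMulVec w (star w))ᴴ *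
        (c • (1 : Matrix ι ι ℂ) - vecMulVec w (star w))) := by
    rw [conjTranspose_sub, conjTranspose_smul, hs, conjTranspose_one, conjTranspose_vecMulVec,
      star_star, sub_mul, mul_sub, mul_sub, hP]
    simp only [smul_mul_assoc, mul_smul_comm, one_mul, mul_one, sub_self, sub_zero]
    rw [← smul_sub, smul_smul, inv_mul_cancel₀ h.ne', one_smul]
  rw [key]
  exact (posSemidef_conjTranspose_mul_self _).smul (inv_nonneg.2 hc)

theorem Matrix.PosSemidef.trace_smul_one_sub {ι : Type*} [Fintype ι] [DecidableEq ι]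
    {A : Matrix ι ι ℂ} (hA : A.PosSemidef) : (A.trace • (1 : Matrix ι ι ℂ) - A).PosSemidef := by
  obtain ⟨m, v, rfl⟩ := posSemidef_iff_eq_sum_vecMulVec.1 hA
  simp only [trace_sum, trace_vecMulVec, Finset.sum_smul, ← Finset.sum_sub_distrib]
  refine posSemidef_sum _ fun i _ => ?_
  rw [dotProduct_comm]
  exact posSemidef_dotProduct_smul_one_sub_vecMulVec (v i)

theorem Matrix.PosSemidef.card_smul_pinch_sub {ι : Type*} [Fintype ι] [DecidableEq ι]
    {A : Matrix ι ι ℂ} (hA : A.PosSemidef) :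
    ((Fintype.card ι : ℂ) • pinch A - A).PosSemidef := by
  have e : (Fintype.card ι : ℂ) • pinch A - A =
      A ⊙ ((star (1 : ι → ℂ) ⬝ᵥ 1) • (1 : Matrix ι ι ℂ) - vecMulVec 1 (star 1)) := by
    ext i j
    by_cases h : i = j
    · subst h
      simp [pinch, mul_sub, mul_comm]
    · simp [pinch, h]
  rw [e]
  exact hA.hadamard (posSemidef_dotProduct_smul_one_sub_vecMulVec 1)

/-- A rank-one contraction `a b†` is a combination of the members of a three-outcome POVM with
unimodular coefficients; geometrically, its numerical range is an ellipse inscribed in a triangle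
whose vertices lie on the unit circle. -/
theorem exists_povm_vecMulVec_of_real {ι : Type*} [Fintype ι] [DecidableEq ι] {a b : ι → ℂ}
    {t : ℝ} (ha : star a ⬝ᵥ a = 1) (hb : star b ⬝ᵥ b = 1) (hab : star a ⬝ᵥ b = (t : ℂ))
    (ht : 0 ≤ t) :
    ∃ (z : Fin 3 → ℂ) (B : Fin 3 → Matrix ι ι ℂ), (∀ i, z i * star (z i) = 1) ∧
      (∀ i, (B i).PosSemidef) ∧ ∑ i, B i = 1 ∧ ∑ i, z i • B i = vecMulVec a (star b) := by
  have hba : star b ⬝ᵥ a = (t : ℂ) := by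
    rw [← star_star a, star_dotProduct_star, hab]
    simp
  have ht1 : t ≤ 1 := by
    have h : 0 ≤ star (a - b) ⬝ᵥ (a - b) := dotProduct_star_self_nonneg _
    rw [star_sub, sub_dotProduct, dotProduct_sub, dotProduct_sub, ha, hb, hab, hba] at h
    have h2 := (Complex.le_def.1 h).1
    simp at h2
    linarith
  obtain ⟨y, hy⟩ : ∃ y : ℝ, y ^ 2 = (1 + t) * (3 - t) / 4 :=
    ⟨√((1 + t) * (3 - t) / 4), Real.sq_sqrt (by nlinarith)⟩
  have hy' : (y : ℂ) ^ 2 = (1 + t) * (3 - t) / 4 := by exact_mod_cast hy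
  have hI := Complex.I_sq
  have hu : (y * Complex.I) ^ 2 = -((1 + t) * (3 - t) / 4) := by rw [mul_pow, hI, hy']; ring
  have expand : ∀ z w : ℂ, z * star z = 1 → w * star w = 1 →
      ((star (a - z • b) ⬝ᵥ (a - z • b)) • (1 : Matrix ι ι ℂ) -
          vecMulVec (a - z • b) (star (a - z • b))) + vecMulVec (a + w • b) (star (a + w • b)) =
        (2 - t * (z + star z)) • (1 : Matrix ι ι ℂ) + (star z + star w) • vecMulVec a (star b) +
          (z + w) • vecMulVec b (star a) := by
    intro z w hz hw
    have hn : star (a - z • b) ⬝ᵥ (a - z • b) = 2 - t * (z + star z) := by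
      simp only [star_sub, star_smul, sub_dotProduct, dotProduct_sub, smul_dotProduct,
        dotProduct_smul, ha, hb, hab, hba, smul_eq_mul]
      linear_combination hz
    rw [hn]
    ext i j
    simp only [Matrix.add_apply, Matrix.sub_apply, Matrix.smul_apply, vecMulVec_apply,
      Pi.star_apply, Pi.add_apply, Pi.sub_apply, Pi.smul_apply, smul_eq_mul, star_add, star_sub,
      star_mul']
    linear_combination (b i * star (b j)) * (hw - hz)
  set z : Fin 3 → ℂ := ![1, (t - 1) / 2 + y * Complex.I, (t - 1) / 2 - y * Complex.I] with hzdef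
  set c : Fin 3 → ℝ := ![1 / (2 * (3 - t)), 1 / ((3 - t) * (2 - t) * (1 + t)),
    1 / ((3 - t) * (2 - t) * (1 + t))] with hcdef
  have hs1 : star ((t - 1) / 2 + y * Complex.I : ℂ) = (t - 1) / 2 - y * Complex.I := by
    simp [sub_eq_add_neg]
  have hs2 : star ((t - 1) / 2 - y * Complex.I : ℂ) = (t - 1) / 2 + y * Complex.I := by
    simp [sub_eq_add_neg]
  have hz : ∀ i, z i * star (z i) = 1 := by
    intro i
    fin_cases i
    · simp [z]
    · change ((t - 1) / 2 + y * Complex.I : ℂ) * star ((t - 1) / 2 + y * Complex.I : ℂ) = 1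
      rw [hs1]
      linear_combination hy' - y ^ 2 * hI
    · change ((t - 1) / 2 - y * Complex.I : ℂ) * star ((t - 1) / 2 - y * Complex.I : ℂ) = 1
      rw [hs2]
      linear_combination hy' - y ^ 2 * hI
  have h1 : (3 - t : ℂ) ≠ 0 := by exact_mod_cast (by linarith : (3 - t : ℝ) ≠ 0)
  have h2 : (2 - t : ℂ) ≠ 0 := by exact_mod_cast (by linarith : (2 - t : ℝ) ≠ 0)
  have h3 : (1 + t : ℂ) ≠ 0 := by exact_mod_cast (by linarith : (1 + t : ℝ) ≠ 0)
  have hw : ∀ i, star (z i) ^ 2 * star (star (z i) ^ 2) = 1 := by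
    intro i
    rw [star_pow, star_star, ← mul_pow, mul_comm, hz, one_pow]
  refine ⟨z, fun i => (c i : ℂ) • (((star (a - z i • b) ⬝ᵥ (a - z i • b)) • (1 : Matrix ι ι ℂ) -
      vecMulVec (a - z i • b) (star (a - z i • b))) +
      vecMulVec (a + star (z i) ^ 2 • b) (star (a + star (z i) ^ 2 • b))), hz, fun i => ?_, ?_, ?_⟩
  · refine ((posSemidef_dotProduct_smul_one_sub_vecMulVec _).add
      (posSemidef_vecMulVec_self_star _)).smul ?_
    rw [Complex.zero_le_real]
    have : 0 < 3 - t := by linarith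
    have : 0 < 2 - t := by linarith
    have : 0 < 1 + t := by linarith
    fin_cases i <;> dsimp [c] <;> positivity
  · simp only [expand _ _ (hz _) (hw _), smul_add, smul_smul, Finset.sum_add_distrib,
      ← Finset.sum_smul]
    have e1 : ∑ i, (c i : ℂ) * (2 - t * (z i + star (z i))) = 1 := by
      simp only [Fin.sum_univ_three, z, c, hs1, hs2, Matrix.cons_val, star_one]
      push_cast
      field_simp
      ring
    have e2 : ∑ i, (c i : ℂ) * (star (z i) + star (star (z i) ^ 2)) = 0 := by
      simp only [star_pow, Fin.sum_univ_three, z, c, hs1, hs2, Matrix.cons_val, star_one]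
      push_cast
      field_simp
      linear_combination 8 * hu
    have e3 : ∑ i, (c i : ℂ) * (z i + star (z i) ^ 2) = 0 := by
      simp only [Fin.sum_univ_three, z, c, hs1, hs2, Matrix.cons_val, star_one]
      push_cast
      field_simp
      linear_combination 8 * hu
    rw [e1, e2, e3]
    simp
  · simp only [expand _ _ (hz _) (hw _), smul_add, smul_smul, Finset.sum_add_distrib,
      ← Finset.sum_smul]
    have e1 : ∑ i, z i * ((c i : ℂ) * (2 - t * (z i + star (z i)))) = 0 := by
      simp only [Fin.sum_univ_three, z, c, hs1, hs2, Matrix.cons_val, star_one]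
      push_cast
      field_simp
      ring
    have e2 : ∑ i, z i * ((c i : ℂ) * (star (z i) + star (star (z i) ^ 2))) = 1 := by
      simp only [star_pow, Fin.sum_univ_three, z, c, hs1, hs2, Matrix.cons_val, star_one]
      push_cast
      field_simp
      linear_combination (2*(-8+12*((t:ℂ)-1))) * hu
    have e3 : ∑ i, z i * ((c i : ℂ) * (z i + star (z i) ^ 2)) = 0 := by
      simp only [Fin.sum_univ_three, z, c, hs1, hs2, Matrix.cons_val, star_one]
      push_cast
      field_simp
      linear_combination (16-8*((t:ℂ)-1)) * hu
    rw [e1, e2, e3]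
    simp

theorem exists_povm_vecMulVec {ι : Type*} [Fintype ι] [DecidableEq ι] {a b : ι → ℂ}
    (ha : star a ⬝ᵥ a = 1) (hb : star b ⬝ᵥ b = 1) :
    ∃ (z : Fin 3 → ℂ) (B : Fin 3 → Matrix ι ι ℂ), (∀ i, z i * star (z i) = 1) ∧
      (∀ i, (B i).PosSemidef) ∧ ∑ i, B i = 1 ∧ ∑ i, z i • B i = vecMulVec a (star b) := by
  obtain ⟨u, hu, huab⟩ : ∃ u : ℂ, u * star u = 1 ∧ u * (star a ⬝ᵥ b) = (‖star a ⬝ᵥ b‖ : ℂ) := by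
    rcases eq_or_ne (star a ⬝ᵥ b) 0 with h | h
    · exact ⟨1, by simp, by simp [h]⟩
    · have hn : (‖star a ⬝ᵥ b‖ : ℂ) ≠ 0 := by simpa using h
      have hs : (star a ⬝ᵥ b) * star (star a ⬝ᵥ b) = (‖star a ⬝ᵥ b‖ : ℂ) ^ 2 := Complex.mul_conj' _
      refine ⟨star (star a ⬝ᵥ b) / ‖star a ⬝ᵥ b‖, ?_, ?_⟩
      · rw [star_div₀, star_star, show star (‖star a ⬝ᵥ b‖ : ℂ) = ‖star a ⬝ᵥ b‖ from
          Complex.conj_ofReal _]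
        field_simp
        linear_combination hs
      · field_simp
        linear_combination hs
  obtain ⟨z, B, hz, hB, h1, hK⟩ := exists_povm_vecMulVec_of_real (a := a) (b := u • b)
    (t := ‖star a ⬝ᵥ b‖) ha
    (by rw [star_smul, smul_dotProduct, dotProduct_smul, hb]
        simp only [smul_eq_mul]
        linear_combination hu)
    (by rw [dotProduct_smul, smul_eq_mul, huab]) (norm_nonneg _)
  refine ⟨fun i => u * z i, B, fun i => ?_, hB, h1, ?_⟩
  · rw [star_mul']
    linear_combination hz i * (u * star u) + hu
  · simp only [mul_smul, ← Finset.smul_sum]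
    rw [hK, star_smul, vecMulVec_smul, smul_smul, hu, one_smul]

namespace IsSeparableMat

variable {M N : ℕ}

theorem sum {ι : Type*} (s : Finset ι) (σ : ι → Matrix (Fin M × Fin N) (Fin M × Fin N) ℂ)
    (h : ∀ i ∈ s, IsSeparableMat (σ i)) : IsSeparableMat (∑ i ∈ s, σ i) := by
  classical
  induction s using Finset.induction_on with
  | empty => exact ⟨0, Fin.elim0, Fin.elim0, fun i => i.elim0, fun i => i.elim0, by simp⟩
  | insert i s hi ih =>
    rw [Finset.sum_insert hi]
    obtain ⟨k, A, B, hA, hB, e⟩ := h i (Finset.mem_insert_self i s)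
    obtain ⟨l, C, D, hC, hD, f⟩ := ih fun j hj => h j (Finset.mem_insert_of_mem hj)
    refine ⟨k + l, Fin.append A C, Fin.append B D, ?_, ?_, ?_⟩
    · intro j
      refine Fin.addCases (fun j => ?_) (fun j => ?_) j <;> simp [hA, hC]
    · intro j
      refine Fin.addCases (fun j => ?_) (fun j => ?_) j <;> simp [hB, hD]
    · simp [e, f, Fin.sum_univ_add]

theorem add {σ τ : Matrix (Fin M × Fin N) (Fin M × Fin N) ℂ} (hσ : IsSeparableMat σ)
    (hτ : IsSeparableMat τ) : IsSeparableMat (σ + τ) := by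
  simpa using sum Finset.univ ![σ, τ] (by simp [Fin.forall_fin_two, hσ, hτ])

theorem kronecker {A : Matrix (Fin M) (Fin M) ℂ} {B : Matrix (Fin N) (Fin N) ℂ}
    (hA : A.PosSemidef) (hB : B.PosSemidef) : IsSeparableMat (A ⊗ₖ B) :=
  ⟨1, fun _ => A, fun _ => B, fun _ => hA, fun _ => hB, by simp⟩

theorem smul {σ : Matrix (Fin M × Fin N) (Fin M × Fin N) ℂ} (hσ : IsSeparableMat σ) {c : ℂ}
    (hc : 0 ≤ c) : IsSeparableMat (c • σ) := by
  obtain ⟨k, A, B, hA, hB, rfl⟩ := hσ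
  rw [Finset.smul_sum]
  refine sum _ _ fun i _ => ?_
  rw [← smul_kronecker]
  exact kronecker ((hA i).smul hc) (hB i)

theorem diagonal {d : Fin M × Fin N → ℂ} (hd : 0 ≤ d) :
    IsSeparableMat (Matrix.diagonal d) := by
  have e : Matrix.diagonal d = ∑ p : Fin M × Fin N,
      (d p • Matrix.diagonal (Pi.single p.1 1)) ⊗ₖ
        (Matrix.diagonal (Pi.single p.2 1) : Matrix (Fin N) (Fin N) ℂ) := by
    simp only [smul_kronecker, diagonal_kronecker_diagonal]
    ext p q
    rw [Matrix.sum_apply]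
    by_cases h : p = q
    · subst h
      rw [Finset.sum_eq_single p]
      · simp
      · rintro r - hr
        have : r.1 ≠ p.1 ∨ r.2 ≠ p.2 := by
          by_contra! h
          exact hr (Prod.ext h.1 h.2)
        rcases this with h | h <;> simp [Pi.single_apply, h.symm]
      · simp
    · simp [h]
  have hs : ∀ (m : ℕ) (i : Fin m), (0 : Fin m → ℂ) ≤ Pi.single i 1 := fun m i =>
    Pi.single_nonneg.2 zero_le_one
  rw [e]
  exact sum _ _ fun p _ => kronecker ((PosSemidef.diagonal (hs _ _)).smul (hd p))
    (PosSemidef.diagonal (hs _ _))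

theorem pinch {σ : Matrix (Fin M × Fin N) (Fin M × Fin N) ℂ} (hσ : σ.PosSemidef) :
    IsSeparableMat (pinch σ) :=
  diagonal fun _ => hσ.diag_nonneg

end IsSeparableMat

/-- The image of `ρ` on `ℂ² ⊗ ℂᴺ` under the map that replaces each diagonal block by its trace
times the identity and multiplies the off-diagonal blocks by `s`. -/
def traceBlocks {N : ℕ} (s : ℂ) (ρ : Matrix (Fin 2 × Fin N) (Fin 2 × Fin N) ℂ) :
    Matrix (Fin 2 × Fin N) (Fin 2 × Fin N) ℂ :=
  of fun p q => if p.1 = q.1 then (if p.2 = q.2 then ∑ j, ρ (p.1, j) (p.1, j) else 0)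
    else s * ρ p q

theorem traceBlocks_sum {N : ℕ} {ι : Type*} (t : Finset ι) (s : ℂ)
    (ρ : ι → Matrix (Fin 2 × Fin N) (Fin 2 × Fin N) ℂ) :
    traceBlocks s (∑ i ∈ t, ρ i) = ∑ i ∈ t, traceBlocks s (ρ i) := by
  ext p q
  simp only [traceBlocks, of_apply, Matrix.sum_apply]
  split_ifs
  · exact Finset.sum_comm
  · simp
  · exact Finset.mul_sum _ _ _

theorem isSeparableMat_traceBlocks_vecMulVec {N : ℕ} {s : ℂ} (hs : s * s = 1) (hs' : star s = s)
    (ψ : Fin 2 × Fin N → ℂ) : IsSeparableMat (traceBlocks s (vecMulVec ψ (star ψ))) := by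
  have normalize : ∀ a : Fin N → ℂ, a ≠ 0 → ∃ (r : ℝ) (a' : Fin N → ℂ),
      star a' ⬝ᵥ a' = 1 ∧ a = (r : ℂ) • a' := by
    intro a ha
    have h0 : 0 < star a ⬝ᵥ a := dotProduct_star_self_pos_iff.2 ha
    obtain ⟨h1, h2⟩ := Complex.lt_def.1 h0
    have hr : ((star a ⬝ᵥ a).re : ℂ) = star a ⬝ᵥ a := Complex.ext (by simp) (by simpa using h2)
    have hsq : ((√(star a ⬝ᵥ a).re : ℝ) : ℂ) ^ 2 = star a ⬝ᵥ a := by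
      rw [← Complex.ofReal_pow, Real.sq_sqrt h1.le, hr]
    have hne : ((√(star a ⬝ᵥ a).re : ℝ) : ℂ) ≠ 0 := by
      intro h
      rw [h] at hsq
      exact h0.ne' (by simpa using hsq.symm)
    refine ⟨√(star a ⬝ᵥ a).re, ((√(star a ⬝ᵥ a).re : ℝ) : ℂ)⁻¹ • a, ?_, ?_⟩
    · have hstar : star ((√(star a ⬝ᵥ a).re : ℝ) : ℂ) = (√(star a ⬝ᵥ a).re : ℝ) :=
        Complex.conj_ofReal _
      rw [star_smul, smul_dotProduct, dotProduct_smul, star_inv₀, hstar, smul_smul, smul_eq_mul,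
        ← mul_inv, ← sq, hsq, inv_mul_cancel₀ h0.ne']
    · rw [smul_smul, mul_inv_cancel₀ hne, one_smul]
  by_cases h : (∀ j, ψ (0, j) = 0) ∨ (∀ j, ψ (1, j) = 0)
  · have e : traceBlocks s (vecMulVec ψ (star ψ)) =
        Matrix.diagonal fun p => ∑ j, ψ (p.1, j) * star (ψ (p.1, j)) := by
      ext ⟨p, i⟩ ⟨q, j⟩
      rcases h with h | h <;> fin_cases p <;> fin_cases q <;>
        simp [traceBlocks, vecMulVec_apply, diagonal_apply, h]
    rw [e]
    exact IsSeparableMat.diagonal fun p => Finset.sum_nonneg fun j _ => mul_star_self_nonneg _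
  · push Not at h
    obtain ⟨⟨i₀, h₀⟩, ⟨i₁, h₁⟩⟩ := h
    obtain ⟨α, a, ha, hψa⟩ := normalize (fun j => ψ (0, j)) fun h => h₀ (congrFun h i₀)
    obtain ⟨β, b, hb, hψb⟩ := normalize (fun j => ψ (1, j)) fun h => h₁ (congrFun h i₁)
    obtain ⟨z, B, hz, hB, hB1, hK⟩ := exists_povm_vecMulVec ha hb
    have e : traceBlocks s (vecMulVec ψ (star ψ)) = ∑ i,
        vecMulVec ![(α : ℂ), β * (s * star (z i))] (star ![(α : ℂ), β * (s * star (z i))]) ⊗ₖ B i := by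
      have hα : star (α : ℂ) = α := Complex.conj_ofReal _
      have hβ : star (β : ℂ) = β := Complex.conj_ofReal _
      have h0 : ∀ j, ψ (0, j) = α * a j := fun j => congrFun hψa j
      have h1 : ∀ j, ψ (1, j) = β * b j := fun j => congrFun hψb j
      have hBH : ∀ k i j, B k i j = star (B k j i) := fun k i j => ((hB k).1.apply i j).symm
      have hB1' : ∀ i j, ∑ k, B k i j = (1 : Matrix (Fin N) (Fin N) ℂ) i j := fun i j => by
        rw [← hB1, Matrix.sum_apply]
      have hK' : ∀ i j, ∑ k, z k * B k i j = a i * star (b j) := fun i j => by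
        have := congrFun (congrFun hK i) j
        simpa [Matrix.sum_apply, vecMulVec_apply] using this
      have ha' : ∑ j, a j * star (a j) = 1 := by rw [← ha, dotProduct_comm]; rfl
      have hb' : ∑ j, b j * star (b j) = 1 := by rw [← hb, dotProduct_comm]; rfl
      ext ⟨p, i⟩ ⟨q, j⟩
      rw [Matrix.sum_apply]
      fin_cases p <;> fin_cases q
      · change (if i = j then ∑ l, ψ (0, l) * star (ψ (0, l)) else 0) =
          ∑ k, α * star (α : ℂ) * B k i j
        have hsum : ∑ l, ψ (0, l) * star (ψ (0, l)) = α * α := by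
          rw [← mul_one ((α : ℂ) * α), ← ha', Finset.mul_sum]
          refine Finset.sum_congr rfl fun l _ => ?_
          rw [h0, star_mul', hα]
          ring
        rw [← Finset.mul_sum, hB1', one_apply, hsum, hα, mul_ite, mul_one, mul_zero]
      · change s * (ψ (0, i) * star (ψ (1, j))) = ∑ k, α * star (β * (s * star (z k))) * B k i j
        rw [h0, h1, star_mul', hβ]
        calc s * (α * a i * (β * star (b j))) = s * α * β * (a i * star (b j)) := by ring
          _ = _ := by
            rw [← hK', Finset.mul_sum]
            refine Finset.sum_congr rfl fun k _ => ?_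
            rw [star_mul', star_mul', star_star, hs', hβ]
            ring
      · change s * (ψ (1, i) * star (ψ (0, j))) = ∑ k, β * (s * star (z k)) * star (α : ℂ) * B k i j
        rw [h0, h1, star_mul', hα]
        calc s * (β * b i * (α * star (a j))) = s * α * β * star (a j * star (b i)) := by
              rw [star_mul', star_star]; ring
          _ = _ := by
            rw [← hK', star_sum, Finset.mul_sum]
            refine Finset.sum_congr rfl fun k _ => ?_
            rw [star_mul', ← hBH]
            ring
      · change (if i = j then ∑ l, ψ (1, l) * star (ψ (1, l)) else 0) =
          ∑ k, β * (s * star (z k)) * star (β * (s * star (z k))) * B k i j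
        have hsum : ∑ l, ψ (1, l) * star (ψ (1, l)) = β * β := by
          rw [← mul_one ((β : ℂ) * β), ← hb', Finset.mul_sum]
          refine Finset.sum_congr rfl fun l _ => ?_
          rw [h1, star_mul', hβ]
          ring
        have hcoef : ∀ k, β * (s * star (z k)) * star (β * (s * star (z k))) = (β * β : ℂ) := by
          intro k
          rw [star_mul', star_mul', star_star, hs', hβ]
          linear_combination β * β * (hz k + z k * star (z k) * hs)
        simp only [hcoef]
        rw [← Finset.mul_sum, hB1', one_apply, hsum, mul_ite, mul_one, mul_zero]
    rw [e]
    exact IsSeparableMat.sum _ _ fun i _ => IsSeparableMat.kronecker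
      (posSemidef_vecMulVec_self_star _) (hB i)

theorem isSeparableMat_traceBlocks {N : ℕ} {s : ℂ} (hs : s * s = 1) (hs' : star s = s)
    {ρ : Matrix (Fin 2 × Fin N) (Fin 2 × Fin N) ℂ} (hρ : ρ.PosSemidef) :
    IsSeparableMat (traceBlocks s ρ) := by
  obtain ⟨m, v, rfl⟩ := posSemidef_iff_eq_sum_vecMulVec.1 hρ
  rw [traceBlocks_sum]
  exact IsSeparableMat.sum _ _ fun i _ => isSeparableMat_traceBlocks_vecMulVec hs hs' (v i)

theorem one_submatrix_id_mul {ι : Type*} [Fintype ι] [DecidableEq ι] (f : ι → ι)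
    (A : Matrix ι ι ℂ) : (1 : Matrix ι ι ℂ).submatrix f id * A = A.submatrix f id := by
  ext i j
  simp [mul_apply, one_apply]

theorem one_kronecker_shift_pow {N : ℕ} [NeZero N] (m : ℕ) :
    ((1 : Matrix (Fin 2) (Fin 2) ℂ) ⊗ₖ shift N) ^ m =
      (1 : Matrix (Fin 2 × Fin N) (Fin 2 × Fin N) ℂ).submatrix
        (fun p => (p.1, p.2 - Fin.ofNat N m)) id := by
  have h1 : shift N = (1 : Matrix (Fin N) (Fin N) ℂ).submatrix (fun j => j - 1) id := by
    ext i j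
    rw [shift, submatrix_apply, one_apply]
    congr 1
    rw [id, sub_eq_iff_eq_add, Fin.ext_iff, Fin.val_add, Fin.val_one']
    simp
  have h2 : (1 : Matrix (Fin 2) (Fin 2) ℂ) ⊗ₖ shift N =
      (1 : Matrix (Fin 2 × Fin N) (Fin 2 × Fin N) ℂ).submatrix (fun p => (p.1, p.2 - 1)) id := by
    rw [h1, ← one_kronecker_one]
    rfl
  induction m with
  | zero => ext; simp; rfl
  | succ m ih =>
    rw [pow_succ', ih, h2, one_submatrix_id_mul, submatrix_submatrix]
    congr 1
    ext1 p
    have : Fin.ofNat N (m + 1) = 1 + Fin.ofNat N m := by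
      ext
      simp [Fin.val_add, add_comm]
    change (p.1, p.2 - 1 - Fin.ofNat N m) = (p.1, p.2 - Fin.ofNat N (m + 1))
    rw [this, sub_sub]

theorem one_kronecker_shift_pow_conj {N : ℕ} [NeZero N]
    (ρ : Matrix (Fin 2 × Fin N) (Fin 2 × Fin N) ℂ) (m : ℕ) :
    ((1 : Matrix (Fin 2) (Fin 2) ℂ) ⊗ₖ shift N) ^ m * ρ *
      (((1 : Matrix (Fin 2) (Fin 2) ℂ) ⊗ₖ shift N) ^ m)ᴴ =
    ρ.submatrix (fun p => (p.1, p.2 - Fin.ofNat N m)) (fun p => (p.1, p.2 - Fin.ofNat N m)) := by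
  rw [one_kronecker_shift_pow, one_submatrix_id_mul, ← conjTranspose_conjTranspose (_ * _),
    conjTranspose_mul, conjTranspose_conjTranspose, one_submatrix_id_mul]
  ext
  simp

theorem sum_pinch_shift {N : ℕ} [NeZero N] (ρ : Matrix (Fin 2 × Fin N) (Fin 2 × Fin N) ℂ) :
    ∑ m ∈ Finset.range N, pinch (((1 : Matrix (Fin 2) (Fin 2) ℂ) ⊗ₖ shift N) ^ m * ρ *
      (((1 : Matrix (Fin 2) (Fin 2) ℂ) ⊗ₖ shift N) ^ m)ᴴ) =
    diagonal fun p => ∑ j, ρ (p.1, j) (p.1, j) := by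
  simp only [one_kronecker_shift_pow_conj, pinch, submatrix_apply]
  rw [Finset.sum_range]
  ext p q
  rw [Matrix.sum_apply]
  by_cases h : p = q
  · subst h
    simp only [diagonal_apply_eq]
    rw [← Equiv.sum_comp (Equiv.subLeft p.2)]
    simp
  · simp [h]

theorem stmt12 {N : ℕ} (hN : 2 ≤ N)
    (ρ : Matrix (Fin 2 × Fin N) (Fin 2 × Fin N) ℂ) (hρ : ρ.PosSemidef)
    (k : ℕ) (hk : k ≤ N - 1)
    (α : ℝ) (hα1 : -(2 * (N : ℝ) - (k : ℝ) - 1) / (3 * (N : ℝ) - 2) ≤ α) (hα2 : α ≤ 1) :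
    IsSeparableMat
      ((((N - k - 1 : ℕ)) : ℂ) • pinch ρ
        + ∑ m ∈ Finset.range N,
            pinch ((((1 : Matrix (Fin 2) (Fin 2) ℂ) ⊗ₖ shift N) ^ m) * ρ *
              ((((1 : Matrix (Fin 2) (Fin 2) ℂ) ⊗ₖ shift N) ^ m)ᴴ))
        + ∑ m ∈ Finset.range (k + 1),
            pinch (((!![(0 : ℂ), 1; 1, 0] ⊗ₖ (1 : Matrix (Fin N) (Fin N) ℂ)) *
                (((1 : Matrix (Fin 2) (Fin 2) ℂ) ⊗ₖ shift N) ^ m)) * ρ *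
              (((!![(0 : ℂ), 1; 1, 0] ⊗ₖ (1 : Matrix (Fin N) (Fin N) ℂ)) *
                (((1 : Matrix (Fin 2) (Fin 2) ℂ) ⊗ₖ shift N) ^ m))ᴴ))
        + (α : ℂ) • ρ) := by
  have : NeZero N := ⟨by omega⟩
  rw [add_right_comm]
  refine .add ?_ (.sum _ _ fun m _ => .pinch (hρ.mul_mul_conjTranspose_same _))
  rw [sum_pinch_shift]
  obtain ⟨n, hn⟩ : ∃ n : ℕ, n = N - k - 1 := ⟨_, rfl⟩
  rw [← hn]
  have hnN : (n : ℝ) + k + 1 = N := by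
    rw [hn]; exact_mod_cast (by omega : N - k - 1 + k + 1 = N)
  have hN' : (2 : ℝ) ≤ N := by exact_mod_cast hN
  have hk0 : (0 : ℝ) ≤ k := k.cast_nonneg
  obtain ⟨s, c, hs, hs', hc, hsc, hc1, hc2⟩ : ∃ (s : ℂ) (c : ℝ), s * s = 1 ∧ star s = s ∧ 0 ≤ c ∧
      (c : ℂ) * s = α ∧ c ≤ 1 ∧ 0 ≤ 1 - c + n / N + α := by
    rcases le_total 0 α with h | h
    · exact ⟨1, α, by simp, by simp, h, by simp, hα2, by
        have : (0 : ℝ) ≤ n / N := by positivity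
        linarith⟩
    · have hd : 0 < 3 * (N : ℝ) - 2 := by linarith
      rw [div_le_iff₀ hd] at hα1
      refine ⟨-1, -α, by simp, by simp, by linarith, by simp, by nlinarith, ?_⟩
      have e : 1 - -α + (n : ℝ) / N + α = (N + n + 2 * N * α) / N := by field_simp; ring
      rw [e]
      refine div_nonneg ?_ (by linarith)
      nlinarith
  have hblock : ∀ i : Fin 2, ((n : ℂ) • pinch (ρ.submatrix (Prod.mk i) (Prod.mk i)) +
      (1 - c : ℂ) • ((ρ.submatrix (Prod.mk i) (Prod.mk i)).trace • (1 : Matrix (Fin N) (Fin N) ℂ)) +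
      (α : ℂ) • ρ.submatrix (Prod.mk i) (Prod.mk i)).PosSemidef := by
    intro i
    have hA := hρ.submatrix (Prod.mk i : Fin N → Fin 2 × Fin N)
    set A := ρ.submatrix (Prod.mk i : Fin N → Fin 2 × Fin N) (Prod.mk i)
    have e : (n : ℂ) • pinch A + (1 - c : ℂ) • (A.trace • (1 : Matrix (Fin N) (Fin N) ℂ)) +
        (α : ℂ) • A = ((n / N : ℝ) : ℂ) • ((Fintype.card (Fin N) : ℂ) • pinch A - A) +
        ((1 - c : ℝ) : ℂ) • (A.trace • (1 : Matrix (Fin N) (Fin N) ℂ) - A) +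
        ((1 - c + n / N + α : ℝ) : ℂ) • A := by
      have hN0 : (N : ℂ) ≠ 0 := by exact_mod_cast (by omega : N ≠ 0)
      rw [Fintype.card_fin]
      push_cast
      match_scalars <;> field_simp <;> ring
    rw [e]
    refine ((hA.card_smul_pinch_sub.smul ?_).add (hA.trace_smul_one_sub.smul ?_)).add (hA.smul ?_)
    · exact Complex.zero_le_real.2 (by positivity)
    · exact Complex.zero_le_real.2 (by linarith)
    · exact Complex.zero_le_real.2 hc2
  have e : (n : ℂ) • pinch ρ + diagonal (fun p : Fin 2 × Fin N => ∑ j, ρ (p.1, j) (p.1, j)) +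
      (α : ℂ) • ρ = (c : ℂ) • traceBlocks s ρ + ∑ i : Fin 2, diagonal (Pi.single i 1) ⊗ₖ
        ((n : ℂ) • pinch (ρ.submatrix (Prod.mk i) (Prod.mk i)) +
          (1 - c : ℂ) • ((ρ.submatrix (Prod.mk i) (Prod.mk i)).trace •
            (1 : Matrix (Fin N) (Fin N) ℂ)) + (α : ℂ) • ρ.submatrix (Prod.mk i) (Prod.mk i)) := by
    ext ⟨p, i⟩ ⟨q, j⟩
    rw [Fin.sum_univ_two]
    by_cases hij : i = j
    · subst hij
      fin_cases p <;> fin_cases q <;>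
        simp [traceBlocks, pinch, trace, ← hsc] <;> ring
    · fin_cases p <;> fin_cases q <;>
        simp [traceBlocks, pinch, trace, ← hsc, hij] <;> ring
  rw [e]
  exact ((isSeparableMat_traceBlocks hs hs' hρ).smul (Complex.zero_le_real.2 hc)).add
    (.sum _ _ fun i _ => .kronecker (.diagonal (Pi.single_nonneg.2 zero_le_one)) (hblock i))
end

section
/- Let 1 ≤ n ≤ M ≤ N, let ρ be a positive semidefinite matrix on ℂ^M ⊗ ℂ^N, and let α be real with -1 ≤ α ≤ n+1. Then the matrix Tr(ρ)·𝟙_{MN} + α·ρ has Schmidt number at most n. -/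
open Matrix
open scoped ComplexOrder

/-- A positive semidefinite matrix σ on ℂ^M ⊗ ℂ^N has Schmidt number at most n if it is a
finite sum of rank-one projectors v v† onto vectors v that are sums of at most n simple
tensors. -/
def SchmidtNumberLE {M N : ℕ}
    (σ : Matrix (Fin M × Fin N) (Fin M × Fin N) ℂ) (n : ℕ) : Prop :=
  ∃ (k : ℕ) (v : Fin k → (Fin M × Fin N → ℂ)),
    (∀ i, ∃ (e : Fin n → (Fin M → ℂ)) (f : Fin n → (Fin N → ℂ)),
        v i = ∑ l, (fun p => e l p.1 * f l p.2)) ∧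
    σ = ∑ i, Matrix.vecMulVec (v i) (star (v i))

open scoped Kronecker

/-- A vector of `ℂ^M ⊗ ℂ^N` that is a sum of `n` simple tensors. -/
def SchmidtRankLE {M N : ℕ} (v : Fin M × Fin N → ℂ) (n : ℕ) : Prop :=
  ∃ (e : Fin n → (Fin M → ℂ)) (f : Fin n → (Fin N → ℂ)),
    v = ∑ l, (fun p => e l p.1 * f l p.2)

namespace SchmidtRankLE

variable {M N n : ℕ}

lemma of_mul (hn : 1 ≤ n) (e : Fin M → ℂ) (f : Fin N → ℂ) :
    SchmidtRankLE (fun p => e p.1 * f p.2) n := by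
  refine ⟨fun l => if l = ⟨0, hn⟩ then e else 0, fun _ => f, ?_⟩
  ext p
  simp [Finset.sum_apply, ite_apply]

lemma local_mul {v : Fin M × Fin N → ℂ} (hv : SchmidtRankLE v n) (a : Fin M → ℂ)
    (b : Fin N → ℂ) : SchmidtRankLE (fun p => a p.1 * b p.2 * v p) n := by
  obtain ⟨e, f, rfl⟩ := hv
  refine ⟨fun l i => a i * e l i, fun l j => b j * f l j, ?_⟩
  ext p
  simp only [Finset.sum_apply, Finset.mul_sum]
  exact Finset.sum_congr rfl fun _ _ => by ring

lemma const_mul {v : Fin M × Fin N → ℂ} (hv : SchmidtRankLE v n) (c : ℂ) :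
    SchmidtRankLE (c • v) n := by
  convert hv.local_mul (fun _ => c) (fun _ => 1) using 1
  ext p
  simp

lemma kronecker_mulVec {M' N' : ℕ} {v : Fin M × Fin N → ℂ} (hv : SchmidtRankLE v n)
    (U : Matrix (Fin M') (Fin M) ℂ) (V : Matrix (Fin N') (Fin N) ℂ) :
    SchmidtRankLE ((U ⊗ₖ V) *ᵥ v) n := by
  obtain ⟨e, f, rfl⟩ := hv
  refine ⟨fun l => U *ᵥ e l, fun l => V *ᵥ f l, ?_⟩
  ext ⟨i, j⟩
  simp only [mulVec, dotProduct, Finset.sum_apply, kroneckerMap_apply, Fintype.sum_prod_type,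
    Finset.sum_mul_sum]
  simp only [Finset.mul_sum]
  refine ((Finset.sum_congr rfl fun _ _ => Finset.sum_comm).trans Finset.sum_comm).trans ?_
  exact Finset.sum_congr rfl fun _ _ => Finset.sum_congr rfl fun _ _ =>
    Finset.sum_congr rfl fun _ _ => by ring

end SchmidtRankLE

namespace SchmidtNumberLE

variable {M N n : ℕ} {σ τ : Matrix (Fin M × Fin N) (Fin M × Fin N) ℂ}

lemma zero : SchmidtNumberLE (0 : Matrix (Fin M × Fin N) (Fin M × Fin N) ℂ) n :=
  ⟨0, Fin.elim0, fun i => i.elim0, by simp⟩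

lemma add (hσ : SchmidtNumberLE σ n) (hτ : SchmidtNumberLE τ n) :
    SchmidtNumberLE (σ + τ) n := by
  obtain ⟨k, v, hv, rfl⟩ := hσ
  obtain ⟨k', v', hv', rfl⟩ := hτ
  refine ⟨k + k', Fin.append v v', fun i => ?_, by simp [Fin.sum_univ_add]⟩
  induction i using Fin.addCases with
  | left i => simpa using hv i
  | right i => simpa using hv' i

lemma sum {ι : Type*} (s : Finset ι) {σ : ι → Matrix (Fin M × Fin N) (Fin M × Fin N) ℂ}
    (h : ∀ i ∈ s, SchmidtNumberLE (σ i) n) : SchmidtNumberLE (∑ i ∈ s, σ i) n :=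
  Finset.sum_induction σ (SchmidtNumberLE · n) (fun _ _ => add) zero h

lemma vecMulVec_self {v : Fin M × Fin N → ℂ} (hv : SchmidtRankLE v n) :
    SchmidtNumberLE (vecMulVec v (star v)) n :=
  ⟨1, fun _ => v, fun _ => hv, by simp⟩

lemma smul (hσ : SchmidtNumberLE σ n) {c : ℝ} (hc : 0 ≤ c) :
    SchmidtNumberLE ((c : ℂ) • σ) n := by
  obtain ⟨k, v, hv, rfl⟩ := hσ
  rw [Finset.smul_sum]
  refine sum _ fun i _ => ?_
  convert vecMulVec_self (SchmidtRankLE.const_mul (hv i) (Real.sqrt c : ℂ)) using 1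
  ext p q
  have : (c : ℂ) = Real.sqrt c * Real.sqrt c := by
    rw [← Complex.ofReal_mul, Real.mul_self_sqrt hc]
  simp only [Matrix.smul_apply, vecMulVec_apply, Pi.star_apply, Pi.smul_apply, smul_eq_mul, star_mul',
    RCLike.star_def, Complex.conj_ofReal]
  rw [this]
  ring

lemma diagonal (hn : 1 ≤ n) {d : Fin M × Fin N → ℝ} (hd : ∀ p, 0 ≤ d p) :
    SchmidtNumberLE (Matrix.diagonal fun p => (d p : ℂ)) n := by
  have key : (Matrix.diagonal fun p => (d p : ℂ)) =
      ∑ p, (d p : ℂ) • vecMulVec (Pi.single p (1 : ℂ)) (star (Pi.single p (1 : ℂ))) := by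
    ext p q
    simp only [Matrix.sum_apply, Matrix.smul_apply, vecMulVec_apply, Pi.star_apply, Pi.single_apply,
      Matrix.diagonal_apply, smul_eq_mul]
    rw [Finset.sum_eq_single p (by intro b _ hb; simp [hb.symm]) (by simp)]
    by_cases h : p = q <;> simp [h, eq_comm]
  rw [key]
  refine sum _ fun p _ => smul (vecMulVec_self ?_) (hd p)
  convert SchmidtRankLE.of_mul hn (Pi.single p.1 1) (Pi.single p.2 1) using 1
  ext q
  simp [Pi.single_apply, Prod.ext_iff, ← ite_and, and_comm]

lemma kronecker_conj {M' N' : ℕ} (hσ : SchmidtNumberLE σ n)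
    (U : Matrix (Fin M') (Fin M) ℂ) (V : Matrix (Fin N') (Fin N) ℂ) :
    SchmidtNumberLE ((U ⊗ₖ V) * σ * (U ⊗ₖ V)ᴴ) n := by
  obtain ⟨k, v, hv, rfl⟩ := hσ
  rw [Matrix.mul_sum, Matrix.sum_mul]
  refine sum _ fun i _ => ?_
  rw [mul_vecMulVec, vecMulVec_mul, ← star_mulVec]
  exact vecMulVec_self (SchmidtRankLE.kronecker_mulVec (hv i) U V)

end SchmidtNumberLE

lemma two_pow_add_two_pow_inj {a b c d : ℕ} (h : 2 ^ a + 2 ^ b = 2 ^ c + 2 ^ d) :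
    (a = c ∧ b = d) ∨ (a = d ∧ b = c) := by
  have aux : ∀ {a b c d : ℕ}, a ≤ b → c ≤ d → 2 ^ a + 2 ^ b = 2 ^ c + 2 ^ d → ¬ b < d := by
    intro a b c d hab _ h hbd
    have h1 : 2 ^ a ≤ 2 ^ b := Nat.pow_le_pow_right (by norm_num) hab
    have h2 : 2 ^ (b + 1) ≤ 2 ^ d := Nat.pow_le_pow_right (by norm_num) hbd
    have h3 : 0 < 2 ^ c := by positivity
    rw [pow_succ] at h2
    omega
  have main : ∀ {a b c d : ℕ}, a ≤ b → c ≤ d → 2 ^ a + 2 ^ b = 2 ^ c + 2 ^ d →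
      a = c ∧ b = d := by
    intro a b c d hab hcd h
    have hbd : b = d := le_antisymm (not_lt.1 (aux hcd hab h.symm)) (not_lt.1 (aux hab hcd h))
    subst hbd
    exact ⟨Nat.pow_right_injective le_rfl (Nat.add_right_cancel h), rfl⟩
  rcases le_total a b with h1 | h1 <;> rcases le_total c d with h2 | h2
  · exact Or.inl (main h1 h2 h)
  · exact Or.inr (main h1 h2 (by omega))
  · exact Or.inr (main h1 h2 (by omega)).symm
  · exact Or.inl (main h1 h2 (by omega)).symm

/-- Phases `z t i` such that averaging over `t` retains only the terms of a tensor matrix that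
are invariant under all diagonal unitaries of the form `Z ⊗ Z*`. -/
lemma exists_dephasing (N : ℕ) : ∃ (K : ℕ) (_ : NeZero K) (z : ZMod K → Fin N → ℂ),
    ∀ i j k l : Fin N, ∑ t, z t i * star (z t j) * star (z t k * star (z t l)) =
      if (i = j ∧ k = l) ∨ (i = k ∧ j = l) then (K : ℂ) else 0 := by
  have : NeZero (2 ^ (N + 1)) := ⟨by positivity⟩
  refine ⟨2 ^ (N + 1), this, fun t i => ZMod.stdAddChar (t * ((2 ^ (i : ℕ) : ℕ) : ZMod (2 ^ (N + 1)))), ?_⟩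
  intro i j k l
  have hterm : ∀ t : ZMod (2 ^ (N + 1)),
      ZMod.stdAddChar (t * ((2 ^ (i : ℕ) : ℕ) : ZMod (2 ^ (N + 1)))) *
        star (ZMod.stdAddChar (t * ((2 ^ (j : ℕ) : ℕ) : ZMod (2 ^ (N + 1))))) *
        star (ZMod.stdAddChar (t * ((2 ^ (k : ℕ) : ℕ) : ZMod (2 ^ (N + 1)))) *
          star (ZMod.stdAddChar (t * ((2 ^ (l : ℕ) : ℕ) : ZMod (2 ^ (N + 1)))))) =
      (ZMod.stdAddChar (t * (((2 ^ (i : ℕ) + 2 ^ (l : ℕ) : ℕ) : ZMod (2 ^ (N + 1))) -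
        ((2 ^ (j : ℕ) + 2 ^ (k : ℕ) : ℕ) : ZMod (2 ^ (N + 1))))) : ℂ) := by
    intro t
    simp only [star_mul', star_star]
    simp only [RCLike.star_def, ← AddChar.map_neg_eq_conj, ← AddChar.map_add_eq_mul]
    congr 1
    push_cast
    ring
  rw [Finset.sum_congr rfl fun t _ => hterm t,
    AddChar.sum_mulShift _ (ZMod.isPrimitive_stdAddChar _), ZMod.card]
  have hbound : ∀ a b : Fin N, 2 ^ (a : ℕ) + 2 ^ (b : ℕ) < 2 ^ (N + 1) := by
    intro a b
    have ha := Nat.pow_lt_pow_right (a := 2) (by norm_num) a.2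
    have hb := Nat.pow_lt_pow_right (a := 2) (by norm_num) b.2
    rw [pow_succ]
    omega
  have hiff : (((2 ^ (i : ℕ) + 2 ^ (l : ℕ) : ℕ) : ZMod (2 ^ (N + 1))) -
      ((2 ^ (j : ℕ) + 2 ^ (k : ℕ) : ℕ) : ZMod (2 ^ (N + 1))) = 0) ↔
      ((i = j ∧ k = l) ∨ (i = k ∧ j = l)) := by
    rw [sub_eq_zero, ZMod.natCast_eq_natCast_iff', Nat.mod_eq_of_lt (hbound _ _),
      Nat.mod_eq_of_lt (hbound _ _)]
    constructor
    · intro h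
      rcases two_pow_add_two_pow_inj h with ⟨h1, h2⟩ | ⟨h1, h2⟩
      · exact Or.inl ⟨Fin.ext h1, Fin.ext h2.symm⟩
      · exact Or.inr ⟨Fin.ext h1, Fin.ext h2.symm⟩
    · rintro (⟨rfl, rfl⟩ | ⟨rfl, rfl⟩) <;> ring
  simp only [hiff, Nat.cast_ite, Nat.cast_zero]

/-- The vector `∑ i, g i • (e i ⊗ e i)`. -/
def diagVec {N : ℕ} (g : Fin N → ℝ) : Fin N × Fin N → ℂ :=
  fun p => if p.1 = p.2 then (g p.1 : ℂ) else 0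

lemma SchmidtNumberLE.dephase {N n : ℕ} {C : Fin N × Fin N → ℝ}
    (hC : SchmidtRankLE (fun p => (C p : ℂ)) n) :
    SchmidtNumberLE (vecMulVec (diagVec fun i => C (i, i)) (star (diagVec fun i => C (i, i))) +
      Matrix.diagonal fun p => ((if p.1 = p.2 then 0 else C p ^ 2 : ℝ) : ℂ)) n := by
  obtain ⟨K, hK, z, hz⟩ := exists_dephasing N
  have hSN := SchmidtNumberLE.smul (c := (K : ℝ)⁻¹) (SchmidtNumberLE.sum Finset.univ fun t _ =>
    SchmidtNumberLE.vecMulVec_self (hC.local_mul (z t) (star (z t)))) (by positivity)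
  convert hSN using 1
  ext ⟨i, j⟩ ⟨k, l⟩
  have hsum : ∀ t, vecMulVec (fun p : Fin N × Fin N => z t p.1 * star (z t) p.2 * (C p : ℂ))
      (star fun p : Fin N × Fin N => z t p.1 * star (z t) p.2 * (C p : ℂ)) (i, j) (k, l) =
      (z t i * star (z t j) * star (z t k * star (z t l))) * (C (i, j) * C (k, l)) := by
    intro t
    simp [vecMulVec_apply]
    ring
  have hK' : (K : ℂ) ≠ 0 := Nat.cast_ne_zero.2 hK.ne
  simp only [Matrix.smul_apply, Matrix.sum_apply, hsum, ← Finset.sum_mul, hz]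
  simp only [Matrix.add_apply, vecMulVec_apply, Pi.star_apply, diagVec, Matrix.diagonal_apply,
    Prod.mk.injEq, smul_eq_mul]
  push_cast
  by_cases hij : i = j <;> by_cases hkl : k = l
  · subst hij hkl
    by_cases hik : i = k <;> simp [hik, hK']
  · subst hij
    have : ¬ (i = k ∧ i = l) := fun h => hkl (h.1.symm.trans h.2)
    simp [hkl, this]
  · subst hkl
    have : ¬ (i = k ∧ j = k) := fun h => hij (h.1.trans h.2.symm)
    simp [hij, this]
  · by_cases h : i = k ∧ j = l
    · obtain ⟨rfl, rfl⟩ := h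
      simp [hij, hK', sq]
    · simp [hij, h]

/-- Group the indices of a nonnegative family into `n` classes, the `n - 1` largest entries being
alone in their class. -/
lemma exists_coloring {N n : ℕ} (hn : 1 ≤ n) {s : Fin N → ℝ} (hs : ∀ i, 0 ≤ s i) :
    ∃ c : Fin N → Fin n, ∀ i j, i ≠ j → c i = c j →
      ((n : ℝ) + 1) * (s i * s j) ≤ ∑ k, s k ^ 2 := by
  let e : Fin N ≃ Fin N := Fin.revPerm.trans (Tuple.sort s)
  have hanti : Antitone (s ∘ e) := fun a b hab =>
    Tuple.monotone_sort s (Fin.rev_le_rev.2 hab)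
  have key : ∀ a b : Fin N, a < b → n - 1 ≤ (a : ℕ) →
      ((n : ℝ) + 1) * (s (e a) * s (e b)) ≤ ∑ k, s k ^ 2 := by
    intro a b hab ha
    have hle : ∀ k ≤ a, s (e a) * s (e b) ≤ s (e k) ^ 2 := fun k hk => by
      rw [sq]
      exact mul_le_mul (hanti hk) (hanti (hk.trans hab.le)) (hs _) (hs _)
    have hdisj : Disjoint (Finset.Iio a) {a, b} := by
      rw [Finset.disjoint_right]
      intro k hk
      rcases Finset.mem_insert.1 hk with rfl | hk
      · simp
      · rw [Finset.mem_singleton.1 hk]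
        simp [hab.le]
    have hcard : (a : ℕ) • (s (e a) * s (e b)) ≤ ∑ k ∈ Finset.Iio a, s (e k) ^ 2 := by
      have := Finset.card_nsmul_le_sum (Finset.Iio a) (fun k => s (e k) ^ 2)
        (s (e a) * s (e b)) fun k hk => hle k (Finset.mem_Iio.1 hk).le
      rwa [Fin.card_Iio] at this
    rw [nsmul_eq_mul] at hcard
    have hn' : (n : ℝ) ≤ (a : ℕ) + 1 := by
      have : n ≤ (a : ℕ) + 1 := by omega
      exact_mod_cast this
    have hprod : 0 ≤ s (e a) * s (e b) := mul_nonneg (hs _) (hs _)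
    calc ((n : ℝ) + 1) * (s (e a) * s (e b))
        ≤ (a : ℕ) * (s (e a) * s (e b)) + 2 * (s (e a) * s (e b)) := by nlinarith
      _ ≤ ∑ k ∈ Finset.Iio a, s (e k) ^ 2 + (s (e a) ^ 2 + s (e b) ^ 2) := by
          nlinarith [sq_nonneg (s (e a) - s (e b))]
      _ = ∑ k ∈ Finset.Iio a ∪ {a, b}, s (e k) ^ 2 := by
          rw [Finset.sum_union hdisj, Finset.sum_pair hab.ne]
      _ ≤ ∑ k, s (e k) ^ 2 :=
          Finset.sum_le_sum_of_subset_of_nonneg (Finset.subset_univ _) fun _ _ _ => sq_nonneg _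
      _ = ∑ k, s k ^ 2 := e.sum_comp fun k => s k ^ 2
  refine ⟨fun i => ⟨min (e.symm i : ℕ) (n - 1), by omega⟩, fun i j hij hc => ?_⟩
  have hc' : min (e.symm i : ℕ) (n - 1) = min (e.symm j : ℕ) (n - 1) := congrArg Fin.val hc
  rcases lt_trichotomy (e.symm i) (e.symm j) with h | h | h
  · have := key _ _ h (by have : (e.symm i : ℕ) < e.symm j := h; omega)
    simpa using this
  · exact absurd (e.symm.injective h) hij
  · have := key _ _ h (by have : (e.symm j : ℕ) < e.symm i := h; omega)
    simpa [mul_comm] using this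

/-- The matrix `‖s‖² 𝟙 + α |s⟩⟨s|` for a vector in Schmidt form, `α ≥ 0`. -/
lemma schmidtNumberLE_diagVec_of_nonneg {N n : ℕ} (hn : 1 ≤ n) {s : Fin N → ℝ}
    (hs : ∀ i, 0 ≤ s i) {α : ℝ} (hα : 0 ≤ α) (hα' : α ≤ n + 1) :
    SchmidtNumberLE (((∑ k, s k ^ 2 : ℝ) : ℂ) • (1 : Matrix (Fin N × Fin N) (Fin N × Fin N) ℂ) +
      (α : ℂ) • vecMulVec (diagVec s) (star (diagVec s))) n := by
  obtain ⟨c, hc⟩ := exists_coloring hn hs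
  let C : Fin N × Fin N → ℝ := fun p =>
    if c p.1 = c p.2 then Real.sqrt (s p.1) * Real.sqrt (s p.2) else 0
  have hCdiag : (fun i => C (i, i)) = s := by
    ext i
    simp [C, Real.mul_self_sqrt (hs i)]
  have hCsq : ∀ p, C p ^ 2 = if c p.1 = c p.2 then s p.1 * s p.2 else 0 := by
    intro p
    by_cases h : c p.1 = c p.2
    · simp [C, h, mul_pow, Real.sq_sqrt (hs _)]
    · simp [C, h]
  have hC : SchmidtRankLE (fun p => (C p : ℂ)) n := by
    refine ⟨fun l i => if c i = l then (Real.sqrt (s i) : ℂ) else 0,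
      fun l j => if c j = l then (Real.sqrt (s j) : ℂ) else 0, ?_⟩
    ext p
    simp only [C, Finset.sum_apply, ite_mul, zero_mul, Finset.sum_ite_eq, Finset.mem_univ,
      if_true, mul_ite, mul_zero]
    by_cases h : c p.1 = c p.2
    · simp [h]
    · simp [h]
  have hdeph := SchmidtNumberLE.dephase hC
  rw [hCdiag] at hdeph
  have hrest : ∀ p : Fin N × Fin N,
      0 ≤ (∑ k, s k ^ 2) - α * (if p.1 = p.2 then 0 else C p ^ 2) := by
    intro p
    have hsum : 0 ≤ ∑ k, s k ^ 2 := Finset.sum_nonneg fun _ _ => sq_nonneg _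
    split_ifs with h
    · simpa using hsum
    · rw [hCsq]
      split_ifs with h'
      · have := mul_le_mul_of_nonneg_right hα' (mul_nonneg (hs p.1) (hs p.2))
        linarith [hc _ _ h h']
      · simpa using hsum
  convert (hdeph.smul hα).add (SchmidtNumberLE.diagonal hn hrest) using 1
  ext p q
  simp only [Matrix.add_apply, Matrix.smul_apply, Matrix.one_apply, Matrix.diagonal_apply,
    smul_eq_mul]
  by_cases h : p = q
  · simp only [h, if_true]
    push_cast
    ring
  · simp [h]

/-- The matrix `‖s‖² 𝟙 - β |s⟩⟨s|` for a vector in Schmidt form, `0 ≤ β ≤ 1`. -/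
lemma schmidtNumberLE_diagVec_of_nonpos {N n : ℕ} (hn : 1 ≤ n) {s : Fin N → ℝ}
    (hs : ∀ i, 0 ≤ s i) {β : ℝ} (hβ : 0 ≤ β) (hβ' : β ≤ 1) :
    SchmidtNumberLE (((∑ k, s k ^ 2 : ℝ) : ℂ) • (1 : Matrix (Fin N × Fin N) (Fin N × Fin N) ℂ) -
      (β : ℂ) • vecMulVec (diagVec s) (star (diagVec s))) n := by
  let δ : Fin N → Fin N → ℝ := fun i j => if i = j then 1 else 0
  let r : Fin N → ℝ := fun i => Real.sqrt (s i)
  have hr : ∀ i, r i * r i = s i := fun i => Real.mul_self_sqrt (hs i)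
  have hr2 : ∀ i, r i ^ 2 = s i := fun i => Real.sq_sqrt (hs i)
  let C : Fin N × Fin N → Fin N × Fin N → ℝ := fun a p =>
    (r a.2 * δ p.1 a.1 + r a.1 * δ p.1 a.2) * (r a.2 * δ p.2 a.1 - r a.1 * δ p.2 a.2)
  have hCdiag : ∀ a i, C a (i, i) = s a.2 * δ i a.1 - s a.1 * δ i a.2 := by
    rintro ⟨p, q⟩ i
    have hδ : ∀ j, δ i j * δ i j = δ i j := fun j => by simp [δ]
    simp only [C]
    linear_combination r q ^ 2 * hδ p - r p ^ 2 * hδ q + δ i p * hr2 q - δ i q * hr2 p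
  have hCoff : ∀ a p, p.1 ≠ p.2 →
      C a p ^ 2 = s p.1 * s p.2 * (δ p.1 a.1 * δ p.2 a.2 + δ p.1 a.2 * δ p.2 a.1) := by
    rintro ⟨p, q⟩ ⟨i, j⟩ (h : i ≠ j)
    by_cases h1 : i = p
    · subst h1
      by_cases h2 : j = q
      · subst h2
        simp [C, δ, h, h.symm, mul_pow, hr2, mul_comm]
      · by_cases h3 : i = q <;> simp [C, δ, h.symm, h2, h3]
    · by_cases h2 : i = q
      · subst h2
        by_cases h3 : j = p
        · subst h3
          simp [C, δ, h, h.symm, mul_pow, hr2, mul_comm]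
        · simp [C, δ, h.symm, h1, h3]
      · simp [C, δ, h1, h2]
  have hC : ∀ a, SchmidtRankLE (fun p => (C a p : ℂ)) n := by
    intro a
    convert SchmidtRankLE.of_mul hn
      (fun i => ((r a.2 * δ i a.1 + r a.1 * δ i a.2 : ℝ) : ℂ))
      (fun j => ((r a.2 * δ j a.1 - r a.1 * δ j a.2 : ℝ) : ℂ)) using 2 with p
    push_cast [C]
    rfl
  have hdeph := SchmidtNumberLE.sum Finset.univ fun a _ => SchmidtNumberLE.dephase (hC a)
  have hrest : ∀ p : Fin N × Fin N,
      0 ≤ if p.1 = p.2 then (1 - β) * ∑ k, s k ^ 2 else (∑ k, s k ^ 2) - β * (s p.1 * s p.2) := by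
    intro p
    have hsum : 0 ≤ ∑ k, s k ^ 2 := Finset.sum_nonneg fun _ _ => sq_nonneg _
    split_ifs with h
    · exact mul_nonneg (sub_nonneg.2 hβ') hsum
    · have h1 : s p.1 ^ 2 + s p.2 ^ 2 ≤ ∑ k, s k ^ 2 := by
        rw [← Finset.sum_pair (f := fun k => s k ^ 2) h]
        exact Finset.sum_le_sum_of_subset_of_nonneg (Finset.subset_univ _)
          fun _ _ _ => sq_nonneg _
      have h2 : 0 ≤ s p.1 * s p.2 := mul_nonneg (hs _) (hs _)
      nlinarith [sq_nonneg (s p.1 - s p.2)]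
  convert (hdeph.smul (c := β / 2) (by positivity)).add
    (SchmidtNumberLE.diagonal hn hrest) using 1
  have hvv : ∑ a, vecMulVec (diagVec fun i => C a (i, i)) (star (diagVec fun i => C a (i, i))) =
      (2 : ℂ) • (Matrix.diagonal (fun p : Fin N × Fin N =>
        if p.1 = p.2 then ((∑ k, s k ^ 2 : ℝ) : ℂ) else 0) -
        vecMulVec (diagVec s) (star (diagVec s))) := by
    ext ⟨i, j⟩ ⟨k, l⟩
    simp only [hCdiag, Matrix.sum_apply, Matrix.smul_apply, Matrix.sub_apply,
      vecMulVec_apply, Pi.star_apply, diagVec, Matrix.diagonal_apply, Prod.mk.injEq, smul_eq_mul]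
    by_cases hij : i = j <;> by_cases hkl : k = l
    · subst hij hkl
      have : ∑ a : Fin N × Fin N, (s a.2 * δ i a.1 - s a.1 * δ i a.2) *
          (s a.2 * δ k a.1 - s a.1 * δ k a.2) =
          2 * ((if i = k then ∑ k, s k ^ 2 else 0) - s i * s k) := by
        have expand : ∀ a : Fin N × Fin N, (s a.2 * δ i a.1 - s a.1 * δ i a.2) *
            (s a.2 * δ k a.1 - s a.1 * δ k a.2) =
            s a.2 ^ 2 * (δ i a.1 * δ k a.1) - s a.2 * δ k a.2 * (s a.1 * δ i a.1) -
              s a.1 * δ k a.1 * (s a.2 * δ i a.2) + s a.1 ^ 2 * (δ i a.2 * δ k a.2) :=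
          fun a => by ring
        simp only [expand]
        by_cases hik : i = k
        · subst hik
          simp [δ, Fintype.sum_prod_type, Finset.sum_add_distrib, Finset.sum_sub_distrib]
          ring
        · simp [δ, Fintype.sum_prod_type, Finset.sum_add_distrib, Finset.sum_sub_distrib, hik]
          ring
      have this' := congrArg (fun x : ℝ => (x : ℂ)) this
      simp only [apply_ite (fun x : ℝ => (x : ℂ)), Complex.ofReal_mul, Complex.ofReal_sub,
        Complex.ofReal_ofNat, Complex.ofReal_zero] at this'
      simpa using this'
    · subst hij
      have : ¬ (i = k ∧ i = l) := fun h => hkl (h.1.symm.trans h.2)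
      simp [hkl, this]
    · simp [hij]
    · simp [hij]
  have hdd : ∑ a, Matrix.diagonal (fun p => ((if p.1 = p.2 then 0 else C a p ^ 2 : ℝ) : ℂ)) =
      (2 : ℂ) • Matrix.diagonal (fun p : Fin N × Fin N =>
        if p.1 = p.2 then 0 else ((s p.1 * s p.2 : ℝ) : ℂ)) := by
    ext p q
    simp only [Matrix.sum_apply, Matrix.smul_apply, Matrix.diagonal_apply, smul_eq_mul]
    by_cases hpq : p = q
    · subst hpq
      by_cases h : p.1 = p.2
      · simp [h]
      · have : ∑ a : Fin N × Fin N, (δ p.1 a.1 * δ p.2 a.2 + δ p.1 a.2 * δ p.2 a.1) = 2 := by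
          simp [δ, Fintype.sum_prod_type, Finset.sum_add_distrib]
          norm_num
        simp only [if_true, h, if_false, hCoff _ _ h]
        rw [← Complex.ofReal_sum, ← Finset.mul_sum, this]
        push_cast
        ring
    · simp [hpq]
  rw [Finset.sum_add_distrib, hvv, hdd]
  ext p q
  simp only [Matrix.add_apply, Matrix.sub_apply, Matrix.smul_apply, Matrix.one_apply,
    Matrix.diagonal_apply, smul_eq_mul]
  by_cases h : p = q
  · subst h
    by_cases h' : p.1 = p.2
    · simp [h']
      ring
    · simp [h']
      ring
  · simp [h]
    ring

/-- **Singular value decomposition** of a square complex matrix. -/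
lemma exists_svd {N : ℕ} (A : Matrix (Fin N) (Fin N) ℂ) :
    ∃ (U V : Matrix (Fin N) (Fin N) ℂ) (s : Fin N → ℝ), U * Uᴴ = 1 ∧ V * Vᴴ = 1 ∧
      (∀ i, 0 ≤ s i) ∧ A = U * Matrix.diagonal (fun i => (s i : ℂ)) * V := by
  have hH : (Aᴴ * A).IsHermitian := isHermitian_conjTranspose_mul_self A
  let e := hH.eigenvectorBasis
  let W : Matrix (Fin N) (Fin N) ℂ := hH.eigenvectorUnitary
  have hW : W * Wᴴ = 1 := Unitary.coe_mul_star_self hH.eigenvectorUnitary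
  have hW' : Wᴴ * W = 1 := Unitary.coe_star_mul_self hH.eigenvectorUnitary
  let f : Fin N → EuclideanSpace ℂ (Fin N) := fun i => WithLp.toLp 2 (A *ᵥ (e i).ofLp)
  have hf : Pairwise fun i j => inner ℂ (f i) (f j) = 0 := by
    intro i j hij
    have h0 : inner ℂ (e i) (e j) = 0 := e.orthonormal.2 hij
    rw [EuclideanSpace.inner_eq_star_dotProduct] at h0 ⊢
    simp only [f]
    rw [dotProduct_comm, star_mulVec, ← dotProduct_mulVec, mulVec_mulVec,
      hH.mulVec_eigenvectorBasis, dotProduct_smul, dotProduct_comm]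
    exact (congrArg _ h0).trans (smul_zero _)
  have hdim : Module.finrank ℂ (EuclideanSpace ℂ (Fin N)) = Fintype.card (Fin N) := by simp
  let b := InnerProductSpace.gramSchmidtOrthonormalBasis hdim f
  have hb : ∀ i, f i = (‖f i‖ : ℂ) • b i := by
    intro i
    by_cases h : f i = 0
    · simp [h]
    · have hn : (‖f i‖ : ℂ) ≠ 0 := by simpa using h
      rw [InnerProductSpace.gramSchmidtOrthonormalBasis_apply_of_orthogonal hdim hf h, smul_smul]
      simp [hn]
  let U : Matrix (Fin N) (Fin N) ℂ := fun i j => b j i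
  have hU : Uᴴ * U = 1 := by
    ext i j
    have := orthonormal_iff_ite.1 b.orthonormal i j
    rw [EuclideanSpace.inner_eq_star_dotProduct, dotProduct_comm] at this
    rw [Matrix.one_apply]
    exact this
  have hAW : A * W = U * Matrix.diagonal (fun i => (‖f i‖ : ℂ)) := by
    ext i j
    rw [mul_diagonal, mul_comm]
    exact congrArg (fun v : EuclideanSpace ℂ (Fin N) => v i) (hb j)
  refine ⟨U, Wᴴ, fun i => ‖f i‖, mul_eq_one_comm.1 hU, by simpa using hW',
    fun i => norm_nonneg _, ?_⟩
  rw [← hAW, Matrix.mul_assoc, hW, Matrix.mul_one]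

/-- **Schmidt decomposition**. -/
lemma exists_schmidt_decomposition {M N : ℕ} (hMN : M ≤ N) (v : Fin M × Fin N → ℂ) :
    ∃ (U : Matrix (Fin M) (Fin N) ℂ) (V : Matrix (Fin N) (Fin N) ℂ) (s : Fin N → ℝ),
      U * Uᴴ = 1 ∧ V * Vᴴ = 1 ∧ (∀ i, 0 ≤ s i) ∧ v = (U ⊗ₖ V) *ᵥ diagVec s ∧
      (vecMulVec v (star v)).trace = ((∑ k, s k ^ 2 : ℝ) : ℂ) := by
  let A : Matrix (Fin N) (Fin N) ℂ := fun i j =>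
    if h : (i : ℕ) < M then v (⟨i, h⟩, j) else 0
  obtain ⟨U, V, s, hU, hV, hs, hA⟩ := exists_svd A
  let ι : Fin M → Fin N := Fin.castLE hMN
  have hι : Function.Injective ι := Fin.castLE_injective hMN
  have hAv : ∀ p : Fin M × Fin N, v p = A (ι p.1) p.2 := fun p => by simp [A, ι]
  refine ⟨U.submatrix ι id, Vᵀ, s, ?_, ?_, hs, ?_, ?_⟩
  · rw [conjTranspose_submatrix, ← submatrix_mul _ _ ι id ι Function.bijective_id, hU,
      submatrix_one _ hι]
  · have := congrArg transpose (mul_eq_one_comm.1 hV)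
    rwa [transpose_mul, transpose_one] at this
  · ext p
    rw [hAv, hA, Matrix.mul_assoc, Matrix.mul_apply]
    simp only [mulVec, dotProduct, kroneckerMap_apply, Fintype.sum_prod_type, diagVec,
      submatrix_apply, id, transpose_apply, diagonal_mul, mul_ite, mul_zero,
      Finset.sum_ite_eq, Finset.mem_univ, if_true]
    exact Finset.sum_congr rfl fun _ _ => by ring
  · have h1 : (vecMulVec v (star v)).trace = (A * Aᴴ).trace := by
      simp only [trace, diag_apply, vecMulVec_apply, Pi.star_apply, Matrix.mul_apply,
        conjTranspose_apply, Fintype.sum_prod_type, hAv]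
      refine Finset.sum_of_injOn ι hι.injOn (by simp) ?_ (fun _ _ => rfl)
      intro i _ hi
      have : ¬ (i : ℕ) < M := fun h => hi ⟨⟨i, h⟩, by simp, Fin.ext rfl⟩
      simp [A, this]
    have h2 : A * Aᴴ = U * (Matrix.diagonal (fun i => ((s i ^ 2 : ℝ) : ℂ)) * Uᴴ) := by
      have hdd : Matrix.diagonal (fun i => (s i : ℂ)) *
          (Matrix.diagonal (fun i => (s i : ℂ)))ᴴ =
          Matrix.diagonal (fun i => ((s i ^ 2 : ℝ) : ℂ)) := by
        rw [diagonal_conjTranspose, diagonal_mul_diagonal]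
        congr 1
        ext i
        simp [sq]
      rw [hA, conjTranspose_mul, conjTranspose_mul, ← hdd]
      simp only [Matrix.mul_assoc]
      rw [← Matrix.mul_assoc V, hV, Matrix.one_mul]
    rw [h1, h2, trace_mul_comm, Matrix.mul_assoc, mul_eq_one_comm.1 hU, Matrix.mul_one,
      trace_diagonal]
    push_cast
    rfl

lemma schmidtNumberLE_of_vecMulVec {M N n : ℕ} (hn : 1 ≤ n) (hMN : M ≤ N)
    (v : Fin M × Fin N → ℂ) {α : ℝ} (hα1 : -1 ≤ α) (hα2 : α ≤ (n : ℝ) + 1) :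
    SchmidtNumberLE ((vecMulVec v (star v)).trace •
      (1 : Matrix (Fin M × Fin N) (Fin M × Fin N) ℂ) + (α : ℂ) • vecMulVec v (star v)) n := by
  obtain ⟨U, V, s, hU, hV, hs, hv, htr⟩ := exists_schmidt_decomposition hMN v
  have hK : (U ⊗ₖ V) * (U ⊗ₖ V)ᴴ = 1 := by
    rw [conjTranspose_kronecker, ← mul_kronecker_mul, hU, hV, one_kronecker_one]
  have hdiag : SchmidtNumberLE (((∑ k, s k ^ 2 : ℝ) : ℂ) •
      (1 : Matrix (Fin N × Fin N) (Fin N × Fin N) ℂ) +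
      (α : ℂ) • vecMulVec (diagVec s) (star (diagVec s))) n := by
    rcases le_total 0 α with h | h
    · exact schmidtNumberLE_diagVec_of_nonneg hn hs h hα2
    · have := schmidtNumberLE_diagVec_of_nonpos hn hs (neg_nonneg.2 h) (by linarith : -α ≤ 1)
      rwa [Complex.ofReal_neg, neg_smul, sub_neg_eq_add] at this
  convert hdiag.kronecker_conj U V using 1
  rw [htr, Matrix.mul_add, Matrix.add_mul, Matrix.mul_smul, Matrix.smul_mul, Matrix.mul_one, hK,
    Matrix.mul_smul, Matrix.smul_mul, mul_vecMulVec, vecMulVec_mul, ← star_mulVec, ← hv]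

theorem stmt16 {M N n : ℕ} (hn : 1 ≤ n) (hnM : n ≤ M) (hMN : M ≤ N)
    (ρ : Matrix (Fin M × Fin N) (Fin M × Fin N) ℂ) (hρ : ρ.PosSemidef)
    (α : ℝ) (hα1 : -1 ≤ α) (hα2 : α ≤ (n : ℝ) + 1) :
    SchmidtNumberLE
      (ρ.trace • (1 : Matrix (Fin M × Fin N) (Fin M × Fin N) ℂ) + (α : ℂ) • ρ) n := by
  obtain ⟨m, v, rfl⟩ := posSemidef_iff_eq_sum_vecMulVec.1 hρ
  rw [trace_sum, Finset.sum_smul, Finset.smul_sum, ← Finset.sum_add_distrib]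
  exact SchmidtNumberLE.sum _ fun i _ => schmidtNumberLE_of_vecMulVec hn hMN (v i) hα1 hα2
end
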